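/- arXiv:2508.12654 — 5 statements merged into one kernel-verified Lean document; each statement's English description precedes it below -/
import Mathlib

section
/- Let m ≥ 1 be an integer, Y any type, π a partition of m, and s ∈ Sym^m Y. Then s ∈ W_π(Y) if and only if π refines the multiplicity partition μ(s) of s, i.e., μ(s) ≥ π. -/
open Multiset

/-- `W π Y` is the set of multisets `a_1•{y_1} + ⋯ + a_k•{y_k}` in `Sym Y m`,
where `(a_1,…,a_k)` are the parts of the partition `π` of `m`. -/
def W {m : ℕ} (π : Nat.Partition m) (Y : Type*) : Set (Sym Y m) :=
  {s | ∃ t : Multiset (ℕ × Y), t.map Prod.fst = π.parts ∧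
        (t.map fun p => Multiset.replicate p.1 p.2).sum = s.1}


/-- `Coarsens π π′` means `π ≥ π′`, i.e. `π′` refines `π`: the parts of `π′` can be
grouped (by a surjection on the index sets of parts) so that each group sums to the
corresponding part of `π`.  Encoded via a multiset `t` of groups of parts. -/
def Coarsens {m : ℕ} (π π' : Nat.Partition m) : Prop :=
  ∃ t : Multiset (Multiset ℕ), t.map Multiset.sum = π.parts ∧ t.sum = π'.parts


/-- The multiplicity partition `μ(s)` of `s ∈ Sym Y m`: its parts are the multiplicities
in `s` of the distinct elements of `s`. -/
def mu {Y : Type*} [DecidableEq Y] {m : ℕ} (s : Sym Y m) : Nat.Partition m where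
  parts := s.1.toFinset.val.map s.1.count
  parts_pos := by
    intro i hi
    rw [Multiset.mem_map] at hi
    obtain ⟨y, hy, rfl⟩ := hi
    exact Multiset.count_pos.mpr (by simpa using hy)
  parts_sum := by
    simpa [Finset.sum] using s.1.toFinset_sum_count_eq.trans s.2


theorem sum_map_replicate_pair {Y : Type*} (g : Multiset ℕ) (y : Y) :
    ((g.map fun a => (a, y)).map fun p => Multiset.replicate p.1 p.2).sum =
      Multiset.replicate g.sum y := by
  induction g using Multiset.induction_on with
  | empty => simp
  | cons a g ih =>
    simp only [Multiset.map_cons, Multiset.sum_cons, ih, Multiset.replicate_add]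

theorem count_sum_map_replicate {Y : Type*} [DecidableEq Y] (t : Multiset (ℕ × Y)) (y : Y) :
    (t.map fun p => Multiset.replicate p.1 p.2).sum.count y =
      ((t.filter fun p => p.2 = y).map Prod.fst).sum := by
  induction t using Multiset.induction_on with
  | empty => simp
  | cons p t ih =>
    by_cases h : p.2 = y <;> simp [ih, h, Multiset.count_replicate]

theorem sum_map_fst_filter_snd {Y : Type*} [DecidableEq Y] (F : Finset Y)
    (t : Multiset (ℕ × Y)) (h : ∀ p ∈ t, p.2 ∈ F) :
    ∑ y ∈ F, (t.filter fun p => p.2 = y).map Prod.fst = t.map Prod.fst := by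
  induction t using Multiset.induction_on with
  | empty => simp
  | cons p t ih =>
    have hp : p.2 ∈ F := h p (Multiset.mem_cons_self p t)
    have ht := ih fun q hq => h q (Multiset.mem_cons_of_mem hq)
    simp only [Multiset.filter_cons, Multiset.map_add, Finset.sum_add_distrib, ht,
      Multiset.map_cons]
    rw [Finset.sum_eq_single_of_mem p.2 hp fun y _ hy => by simp [hy.symm]]
    simp

theorem exists_pairs_of_rel {Y : Type*} {c : Y → ℕ} {T : Multiset (Multiset ℕ)}
    {S : Multiset Y} (h : Multiset.Rel (fun g y => g.sum = c y) T S) :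
    ∃ t : Multiset (ℕ × Y), t.map Prod.fst = T.sum ∧
      (t.map fun p => Multiset.replicate p.1 p.2).sum =
        (S.map fun y => Multiset.replicate (c y) y).sum := by
  induction h with
  | zero => exact ⟨0, by simp⟩
  | @cons g y T S hgy _ ih =>
    obtain ⟨t, ht, hts⟩ := ih
    refine ⟨g.map (fun a => (a, y)) + t, ?_, ?_⟩
    · simp [ht]
    · rw [Multiset.map_add, Multiset.sum_add, sum_map_replicate_pair, hts, hgy,
        Multiset.map_cons, Multiset.sum_cons]

/-- `s ∈ W_π(Y)` if and only if the multiplicity partition `μ(s)` of `s` is a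
coarsening of `π`, i.e. `μ(s) ≥ π`. -/
theorem mem_W_iff_coarsens_mu (m : ℕ) (hm : 1 ≤ m) (Y : Type*) [DecidableEq Y]
    (π : Nat.Partition m) (s : Sym Y m) :
    s ∈ W π Y ↔ Coarsens (mu s) π := by
  constructor
  · rintro ⟨t, htπ, hts⟩
    refine ⟨s.1.toFinset.val.map fun y => (t.filter fun p => p.2 = y).map Prod.fst, ?_, ?_⟩
    · simp only [mu, Multiset.map_map, ← hts, count_sum_map_replicate, Function.comp_def]
    · rw [← htπ]
      refine sum_map_fst_filter_snd s.1.toFinset t fun p hp => ?_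
      have hpos : 0 < p.1 := π.parts_pos (htπ ▸ Multiset.mem_map_of_mem Prod.fst hp)
      rw [Multiset.mem_toFinset, ← hts]
      exact Multiset.mem_bind.mpr ⟨p, hp, by simp [Multiset.mem_replicate, hpos.ne']⟩
  · rintro ⟨T, hTμ, hTπ⟩
    have hrel : Multiset.Rel (fun g y => g.sum = s.1.count y) T s.1.toFinset.val :=
      Multiset.rel_map.mp (Multiset.rel_eq.mpr hTμ)
    obtain ⟨t, ht, hts⟩ := exists_pairs_of_rel hrel
    refine ⟨t, ht.trans hTπ, hts.trans ?_⟩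
    simpa [Multiset.nsmul_singleton, Finset.sum] using
      Multiset.toFinset_sum_count_nsmul_eq s.1
end

section
/- Let m ≥ 1 be an integer, Y any type, and k an integer with 1 ≤ k ≤ m. Then ⋃_{|π| = k} W_π(Y), the union over all partitions π of m with exactly k parts, equals the set of multisets s ∈ Sym^m Y having at most k distinct elements (i.e., the support of s has cardinality ≤ k). This is the set-theoretic description of the t-th iterated singular locus Sing^t(S^m Y) for k = m − t in Theorem 2(iii) of the paper. -/
open Multiset

lemma Multiset.card_sum_map_replicate {Y : Type*} (t : Multiset (ℕ × Y)) :
    card (t.map fun p => replicate p.1 p.2).sum = (t.map Prod.fst).sum := by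
  induction t using Multiset.induction_on with
  | empty => simp
  | cons p t ih => simp [ih]

lemma Multiset.card_toFinset_sum_map_replicate_le {Y : Type*} [DecidableEq Y]
    (t : Multiset (ℕ × Y)) :
    (t.map fun p => replicate p.1 p.2).sum.toFinset.card ≤ card t := by
  have hsub : (t.map fun p => replicate p.1 p.2).sum.toFinset ⊆ (t.map Prod.snd).toFinset := by
    intro y hy
    rw [mem_toFinset, ← join, mem_join] at hy
    simp only [mem_toFinset, mem_map] at hy ⊢
    obtain ⟨_, ⟨p, hp, rfl⟩, hy⟩ := hy
    exact ⟨p, hp, (eq_of_mem_replicate hy).symm⟩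
  calc _ ≤ (t.map Prod.snd).toFinset.card := Finset.card_le_card hsub
    _ ≤ card (t.map Prod.snd) := toFinset_card_le _
    _ = card t := card_map _ _

/-- A multiset `s` is a sum of exactly `k` constant nonempty multisets, for every `k` between the
number of distinct elements of `s` and its cardinality. -/
lemma Multiset.exists_sum_map_replicate_eq {Y : Type*} [DecidableEq Y] (s : Multiset Y) {k : ℕ}
    (hk : s.toFinset.card ≤ k) (hks : k ≤ card s) :
    ∃ t : Multiset (ℕ × Y), card t = k ∧ (∀ p ∈ t, 0 < p.1) ∧
      (t.map fun p => replicate p.1 p.2).sum = s := by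
  induction k, hk using Nat.le_induction with
  | base =>
    refine ⟨s.toFinset.val.map fun y => (s.count y, y), card_map _ _, ?_, ?_⟩
    · simp [count_pos]
    · rw [map_map]
      have h := toFinset_sum_count_nsmul_eq s
      simp only [nsmul_singleton] at h
      exact h
  | succ k _ ih =>
    obtain ⟨t, htk, hpos, hsum⟩ := ih (by omega)
    obtain ⟨p, hp, hp2⟩ : ∃ p ∈ t, 1 < p.1 := by
      by_contra! h
      have hle : (t.map Prod.fst).sum ≤ card (t.map Prod.fst) • 1 :=
        sum_le_card_nsmul _ _ (by simpa using fun a b hab => h (a, b) hab)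
      rw [← card_sum_map_replicate, hsum, card_map, htk, smul_eq_mul] at hle
      omega
    obtain ⟨u, rfl⟩ := exists_cons_of_mem hp
    obtain ⟨a, y⟩ := p
    refine ⟨(1, y) ::ₘ (a - 1, y) ::ₘ u, by simpa using htk, ?_, ?_⟩
    · simp only [mem_cons, forall_eq_or_imp] at hpos ⊢
      exact ⟨one_pos, Nat.sub_pos_of_lt hp2, hpos.2⟩
    · rw [← hsum]
      simp only [map_cons, sum_cons]
      rw [← add_assoc, ← replicate_add, Nat.add_sub_cancel' hp2.le]

/-- The union of the `W_π(Y)` over all partitions `π` of `m` with exactly `k` parts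
equals the set of multisets in `Sym^m Y` with at most `k` distinct elements.
(Set-theoretic description of `Sing^t(S^m Y)` for `k = m - t`.) -/
theorem iUnion_W_card_parts_eq (m : ℕ) (Y : Type*) [DecidableEq Y]
    (k : ℕ) (hk1 : 1 ≤ k) (hkm : k ≤ m) :
    (⋃ (π : Nat.Partition m) (_ : Multiset.card π.parts = k), W π Y) =
      {s : Sym Y m | s.1.toFinset.card ≤ k} := by
  ext s
  simp only [Set.mem_iUnion, Set.mem_ofPred_eq, W, exists_prop]
  constructor
  · rintro ⟨π, hπ, t, ht, hs⟩
    rw [← hs, ← hπ, ← ht, card_map]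
    exact card_toFinset_sum_map_replicate_le t
  · intro h
    obtain ⟨t, htk, hpos, hsum⟩ := exists_sum_map_replicate_eq s.1 h (hkm.trans_eq s.2.symm)
    refine ⟨⟨t.map Prod.fst, ?_, ?_⟩, by simpa using htk, t, rfl, hsum⟩
    · intro i hi
      obtain ⟨p, hp, rfl⟩ := mem_map.1 hi
      exact hpos p hp
    · rw [← card_sum_map_replicate, hsum, s.2]
end

section
/- Let ℓ ≥ 1, let a_1 > a_2 > … > a_ℓ ≥ 1 and r_1,…,r_ℓ ≥ 1 be integers, let m = ∑_{i=1}^ℓ r_i a_i, and let π be the partition of m having the part a_i with multiplicity r_i for each i. Let Y be any type and let α : ∏_{i=1}^ℓ Sym^{r_i} Y → Sym^m Y be the map (s_1,…,s_ℓ) ↦ ∑_{i=1}^ℓ a_i • s_i, where a • s denotes the multiset obtained from s by multiplying every multiplicity by a. Then the image of α is exactly W_π(Y), and α restricts to a bijection from α^{-1}(W°_π(Y)) onto W°_π(Y) (every element of W°_π(Y) has exactly one preimage under α). This is the set-theoretic content of the normalization statement in Lemma 2.1(vi) of the paper. -/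
open Multiset

/-- `Wo π Y = W π Y \ ⋃_{π′ > π} W π′ Y`, the open stratum. -/
def Wo {m : ℕ} (π : Nat.Partition m) (Y : Type*) : Set (Sym Y m) :=
  W π Y \ ⋃ (π' : Nat.Partition m) (_ : Coarsens π' π ∧ π' ≠ π), W π' Y


/-- The multiset `∑ b • {y}`, summed over the weighted points `(b, y)` of `t`. -/
def expand {Y : Type*} (t : Multiset (ℕ × Y)) : Multiset Y :=
  (t.map fun p => Multiset.replicate p.1 p.2).sum

/-- The multiset of weighted points obtained by giving every point of `s i` the weight `a i`. -/
def weighted {ι Y : Type*} [Fintype ι] (a : ι → ℕ) (s : ι → Multiset Y) : Multiset (ℕ × Y) :=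
  ∑ i, (s i).map (Prod.mk (a i))

lemma expand_cons {Y : Type*} (p : ℕ × Y) (t : Multiset (ℕ × Y)) :
    expand (p ::ₘ t) = Multiset.replicate p.1 p.2 + expand t := by
  simp [expand]

lemma mem_expand {Y : Type*} {t : Multiset (ℕ × Y)} {y : Y} :
    y ∈ expand t ↔ ∃ b, b ≠ 0 ∧ (b, y) ∈ t := by
  induction t using Multiset.induction_on with
  | empty => simp [expand]
  | cons p t ih =>
    obtain ⟨c, z⟩ := p
    simp only [expand_cons, Multiset.mem_add, Multiset.mem_replicate, ih, Multiset.mem_cons,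
      Prod.mk.injEq, and_or_left, exists_or]
    refine or_congr_left ⟨fun h => ⟨c, h.1, rfl, h.2⟩, ?_⟩
    rintro ⟨_, hc, rfl, h⟩
    exact ⟨hc, h⟩

lemma expand_map_mk {Y : Type*} (b : ℕ) (s : Multiset Y) :
    expand (s.map (Prod.mk b)) = b • s := by
  induction s using Multiset.induction_on with
  | empty => simp [expand]
  | cons y s ih =>
    rw [Multiset.map_cons, expand_cons, ih, ← Multiset.singleton_add y s, nsmul_add,
      Multiset.nsmul_singleton]

lemma expand_add {Y : Type*} (t u : Multiset (ℕ × Y)) :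
    expand (t + u) = expand t + expand u := by
  simp [expand]

lemma expand_weighted {ι Y : Type*} [Fintype ι] (a : ι → ℕ) (s : ι → Multiset Y) :
    expand (weighted a s) = ∑ i, a i • s i := by
  let e : Multiset (ℕ × Y) →+ Multiset Y :=
    { toFun := expand, map_zero' := by simp [expand], map_add' := expand_add }
  change e (∑ i, (s i).map (Prod.mk (a i))) = _
  rw [map_sum]
  exact Finset.sum_congr rfl fun i _ => expand_map_mk _ _

lemma map_fst_weighted {ι Y : Type*} [Fintype ι] (a : ι → ℕ) (s : ι → Multiset Y) :
    (weighted a s).map Prod.fst = ∑ i, Multiset.replicate (Multiset.card (s i)) (a i) := by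
  rw [weighted, ← Multiset.coe_mapAddMonoidHom, map_sum]
  simp [Multiset.map_map]

lemma count_weighted {ι Y : Type*} [Fintype ι] [DecidableEq Y] {a : ι → ℕ}
    (ha : Function.Injective a) (s : ι → Multiset Y) (i : ι) (y : Y) :
    (weighted a s).count (a i, y) = (s i).count y := by
  rw [weighted, Multiset.count_sum', Finset.sum_eq_single i]
  · exact Multiset.count_map_eq_count' _ _ (Prod.mk_right_injective _) _
  · intro j _ hj
    rw [Multiset.count_eq_zero]
    simp [ha.eq_iff, hj]
  · simp

lemma weighted_injective {ι Y : Type*} [Fintype ι] {a : ι → ℕ}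
    (ha : Function.Injective a) :
    Function.Injective (weighted a : (ι → Multiset Y) → Multiset (ℕ × Y)) := by
  classical
  intro s s' h
  funext i
  ext y
  rw [← count_weighted ha, h, count_weighted ha]

/-- Collecting the points of each weight recovers a multiset all of whose weights are values
of `a`. -/
lemma weighted_filter {ι Y : Type*} [Fintype ι] {a : ι → ℕ} (ha : Function.Injective a)
    (t : Multiset (ℕ × Y)) (ht : ∀ p ∈ t, ∃ i, a i = p.1) :
    weighted a (fun i => (t.filter fun p => p.1 = a i).map Prod.snd) = t := by
  classical
  ext ⟨b, y⟩
  by_cases hb : ∃ i, a i = b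
  · obtain ⟨i, rfl⟩ := hb
    rw [count_weighted ha, Multiset.count_map, Multiset.filter_filter, Multiset.count,
      Multiset.countP_eq_card_filter]
    congr 1
    refine Multiset.filter_congr fun p _ => ?_
    simp only [Prod.ext_iff]
    tauto
  · rw [Multiset.count_eq_zero.2, Multiset.count_eq_zero.2]
    · exact fun h => hb (ht _ h)
    · simp only [weighted, Multiset.mem_sum, Multiset.mem_map, Prod.mk.injEq]
      rintro ⟨i, _, _, _, rfl, _⟩
      exact hb ⟨i, rfl⟩

lemma count_expand {Y : Type*} [DecidableEq Y] {t : Multiset (ℕ × Y)}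
    (ht : (t.map Prod.snd).Nodup) {b : ℕ} {y : Y} (h : (b, y) ∈ t) :
    (expand t).count y = b := by
  obtain ⟨u, rfl⟩ := Multiset.exists_cons_of_mem h
  rw [Multiset.map_cons, Multiset.nodup_cons] at ht
  rw [expand_cons, Multiset.count_add, Multiset.count_replicate_self,
    Multiset.count_eq_zero.2, add_zero]
  rw [mem_expand]
  rintro ⟨c, _, hc⟩
  exact ht.1 (Multiset.mem_map.2 ⟨_, hc, rfl⟩)

/-- Positive weights at distinct points are determined by the multiset they define. -/
lemma eq_of_expand_eq {Y : Type*} {t u : Multiset (ℕ × Y)}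
    (ht : (t.map Prod.snd).Nodup) (hu : (u.map Prod.snd).Nodup)
    (ht0 : ∀ p ∈ t, p.1 ≠ 0) (hu0 : ∀ p ∈ u, p.1 ≠ 0) (h : expand t = expand u) : t = u := by
  classical
  have key : ∀ {t u : Multiset (ℕ × Y)}, (t.map Prod.snd).Nodup → (u.map Prod.snd).Nodup →
      (∀ p ∈ t, p.1 ≠ 0) → expand t = expand u → ∀ p ∈ t, p ∈ u := by
    rintro t u ht hu ht0 h ⟨b, y⟩ hp
    have hy : y ∈ expand u := h ▸ mem_expand.2 ⟨b, ht0 _ hp, hp⟩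
    obtain ⟨c, _, hc⟩ := mem_expand.1 hy
    have hbc : b = c := by rw [← count_expand ht hp, h, count_expand hu hc]
    rwa [hbc]
  exact (Multiset.Nodup.ext ht.of_map hu.of_map).2
    fun p => ⟨key ht hu ht0 h p, key hu ht hu0 h.symm p⟩

/-- Two weighted points at the same position could be merged, which would give a strictly
coarser partition; hence the points over the open stratum are distinct. -/
lemma nodup_map_snd_of_mem_Wo {m : ℕ} {π : Nat.Partition m} {Y : Type*} {s : Sym Y m}
    (hs : s ∈ Wo π Y) {t : Multiset (ℕ × Y)} (ht : t.map Prod.fst = π.parts)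
    (hts : expand t = s.1) : (t.map Prod.snd).Nodup := by
  rw [Multiset.nodup_iff_ne_cons_cons]
  intro y u hu
  obtain ⟨⟨b, z⟩, t₁, rfl, rfl, ht₁⟩ :
      ∃ p t₁, t = p ::ₘ t₁ ∧ p.2 = y ∧ t₁.map Prod.snd = y ::ₘ u := by
    obtain ⟨p, hp, hpy⟩ := Multiset.mem_map.1 (hu ▸ Multiset.mem_cons_self y _)
    obtain ⟨t₁, rfl⟩ := Multiset.exists_cons_of_mem hp
    refine ⟨p, t₁, rfl, hpy, ?_⟩
    simpa [hpy] using hu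
  obtain ⟨⟨c, w⟩, hp, hpy⟩ := Multiset.mem_map.1 (ht₁ ▸ Multiset.mem_cons_self z u)
  obtain ⟨t₀, rfl⟩ := Multiset.exists_cons_of_mem hp
  obtain rfl : w = z := hpy
  simp only [Multiset.map_cons] at ht
  have hb : 0 < b := π.parts_pos (ht ▸ Multiset.mem_cons_self b _)
  let π' : Nat.Partition m :=
    { parts := (b + c) ::ₘ t₀.map Prod.fst
      parts_pos := by
        intro i hi
        rcases Multiset.mem_cons.1 hi with rfl | hi
        · omega
        · exact π.parts_pos (ht ▸ Multiset.mem_cons_of_mem (Multiset.mem_cons_of_mem hi))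
      parts_sum := by
        rw [← π.parts_sum, ← ht]
        simp [add_assoc] }
  refine hs.2 (Set.mem_iUnion₂.2 ⟨π', ⟨?_, ?_⟩, (b + c, w) ::ₘ t₀, ?_, ?_⟩)
  · refine ⟨{b, c} ::ₘ (t₀.map Prod.fst).map fun x => {x}, ?_, ?_⟩
    · simp [π']
    · rw [← ht, Multiset.sum_cons, Multiset.sum_map_singleton]
      simp
  · intro h
    have := congrArg (fun ρ : Nat.Partition m => Multiset.card ρ.parts) h
    simp [π', ← ht] at this
  · simp [π']
  · rw [← hts]
    change expand _ = _
    simp [expand_cons, Multiset.replicate_add, add_assoc]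

/-- Let `a_1 > … > a_ℓ ≥ 1` with multiplicities `r_1,…,r_ℓ ≥ 1`, `m = ∑ r_i a_i`,
and let `π` be the partition of `m` with part `a_i` of multiplicity `r_i`.  The map
`α : ∏ᵢ Sym^{r_i} Y → Sym^m Y`, `(s_1,…,s_ℓ) ↦ ∑ᵢ a_i • s_i` (where `a • s`
multiplies every multiplicity in `s` by `a`), has image exactly `W_π(Y)`, and every
element of `W°_π(Y)` has exactly one preimage under `α` (so `α` restricts to a
bijection onto `W°_π(Y)`).  This is the set-theoretic content of the normalization
statement of Lemma 2.1(vi). -/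
theorem range_alpha_eq_W_and_bijOn_Wo
    {ℓ : ℕ} (hℓ : 1 ≤ ℓ) (a r : Fin ℓ → ℕ)
    (ha_anti : StrictAnti a) (ha1 : ∀ i, 1 ≤ a i) (hr1 : ∀ i, 1 ≤ r i)
    (m : ℕ) (hm : m = ∑ i, r i * a i)
    (π : Nat.Partition m) (hπ : π.parts = ∑ i, Multiset.replicate (r i) (a i))
    (Y : Type*)
    (α : (∀ i, Sym Y (r i)) → Sym Y m)
    (hα : ∀ s, (α s).1 = ∑ i, a i • (s i).1) :
    Set.range α = W π Y ∧ ∀ s ∈ Wo π Y, ∃! t, α t = s := by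
  have ha : Function.Injective a := ha_anti.injective
  have hfst (s : ∀ i, Sym Y (r i)) :
      (weighted a fun i => (s i).1).map Prod.fst = π.parts := by
    rw [map_fst_weighted, hπ]
    exact Finset.sum_congr rfl fun i _ => by rw [(s i).2]
  have hexp (s : ∀ i, Sym Y (r i)) : expand (weighted a fun i => (s i).1) = (α s).1 := by
    rw [expand_weighted, hα]
  have hrange : Set.range α = W π Y := by
    refine Set.Subset.antisymm ?_ ?_
    · rintro _ ⟨s, rfl⟩
      exact ⟨_, hfst s, hexp s⟩
    · rintro s ⟨t, ht, hts⟩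
      have hcard (i : Fin ℓ) :
          Multiset.card ((t.filter fun p => p.1 = a i).map Prod.snd) = r i := by
        have hcount : Multiset.count (a i) (t.map Prod.fst) = r i := by
          rw [ht, hπ, Multiset.count_sum', Finset.sum_eq_single i]
          · exact Multiset.count_replicate_self _ _
          · intro j _ hj
            rw [Multiset.count_replicate, if_neg (ha.ne hj)]
          · simp
        rw [← hcount, Multiset.card_map, Multiset.count_map]
        simp only [eq_comm]
      refine ⟨fun i => Sym.mk _ (hcard i), Subtype.ext ((hexp _).symm.trans ?_)⟩
      refine (congrArg expand (weighted_filter ha t fun p hp => ?_)).trans hts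
      have hp' : p.1 ∈ π.parts := ht ▸ Multiset.mem_map_of_mem Prod.fst hp
      rw [hπ, Multiset.mem_sum] at hp'
      obtain ⟨i, _, hi⟩ := hp'
      exact ⟨i, (Multiset.eq_of_mem_replicate hi).symm⟩
  refine ⟨hrange, fun s hs => ?_⟩
  obtain ⟨t, rfl⟩ : s ∈ Set.range α := hrange ▸ hs.1
  refine ⟨t, rfl, fun t' ht' => ?_⟩
  have hne (u : ∀ i, Sym Y (r i)) : ∀ p ∈ weighted a fun i => (u i).1, p.1 ≠ 0 := fun p hp =>
    (π.parts_pos (hfst u ▸ Multiset.mem_map_of_mem Prod.fst hp)).ne'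
  have hexp' : expand (weighted a fun i => (t' i).1) = (α t).1 := by rw [hexp, ht']
  have hw := weighted_injective ha <| eq_of_expand_eq
    (nodup_map_snd_of_mem_Wo hs (hfst t') hexp') (nodup_map_snd_of_mem_Wo hs (hfst t) (hexp t))
    (hne t') (hne t) (hexp'.trans (hexp t).symm)
  exact funext fun i => Subtype.ext (congrFun hw i)
end

section
/- Let K be a field of characteristic zero, U a K-vector space, ι a finite type, k ≥ 2 an integer, and b : ι → Fin k a surjective map (so b partitions ι into k ≥ 2 nonempty blocks). Let D be the K-subspace of the function space ι → U consisting of all functions that are constant on each fiber of b. Then the K-linear span of ⋃_{σ ∈ Perm(ι)} { v ∘ σ : v ∈ D } is the whole space ι → U. (This is the Claim established in the proof of Lemma 2.5 of the paper: the sum ∑_{σ ∈ S_m} σ(T_z D) equals U^m when the partition has more than one part.) -/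
theorem Pi.single_comp_perm {ι U : Type*} [DecidableEq ι] [Zero U]
    (i : ι) (u : U) (σ : Equiv.Perm ι) :
    (Pi.single i u : ι → U) ∘ σ = Pi.single (σ.symm i) u := by
  ext x
  simp [Pi.single_apply, Equiv.eq_symm_apply]

/-- A permutation-invariant subspace of `ι → U` containing a difference of two copies of `u`
at distinct coordinates and the constant function `u` contains every copy of `u`. -/
theorem Submodule.single_mem_of_perm_invariant {K U ι : Type*} [Field K] [CharZero K]
    [AddCommGroup U] [Module K U] [Fintype ι] [DecidableEq ι] {S : Submodule K (ι → U)}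
    (hS : ∀ (σ : Equiv.Perm ι), ∀ v ∈ S, v ∘ σ ∈ S) {p q : ι} (hpq : p ≠ q) {u : U}
    (hsub : Pi.single p u - Pi.single q u ∈ S) (hconst : (fun _ => u) ∈ S) (i : ι) :
    Pi.single i u ∈ S := by
  have hdiff (j : ι) : (Pi.single p u - Pi.single j u : ι → U) ∈ S := by
    by_cases hj : j = p
    · simp [hj]
    · have h := hS (Equiv.swap q j) _ hsub
      rw [Pi.sub_comp, Pi.single_comp_perm, Pi.single_comp_perm] at h
      simpa [Equiv.swap_apply_of_ne_of_ne hpq (Ne.symm hj)] using h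
  have hsum : (Fintype.card ι : K) • (Pi.single p u : ι → U) ∈ S := by
    have h := S.add_mem (S.sum_mem fun j (_ : j ∈ Finset.univ) => hdiff j) hconst
    rw [Finset.sum_sub_distrib, Finset.univ_sum_single (fun _ : ι => u)] at h
    simpa [Nat.cast_smul_eq_nsmul] using h
  have hcard : (Fintype.card ι : K) ≠ 0 :=
    Nat.cast_ne_zero.mpr (Fintype.card_pos_iff.mpr ⟨p⟩).ne'
  have h := hS (Equiv.swap p i) _ ((S.smul_mem_iff hcard).mp hsum)
  rw [Pi.single_comp_perm] at h
  simpa using h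

/-- Let `K` be a field of characteristic zero, `U` a `K`-vector space, `ι` a finite
type, `k ≥ 2`, and `b : ι → Fin k` surjective.  Let `D` be the subspace of `ι → U`
of functions constant on each fiber of `b`.  Then the span of the union over all
permutations `σ` of `ι` of the translates `{v ∘ σ : v ∈ D}` is the whole space
`ι → U`.  (The Claim in the proof of Lemma 2.5.) -/
theorem span_perm_translates_eq_top
    (K : Type*) [Field K] [CharZero K]
    (U : Type*) [AddCommGroup U] [Module K U]
    (ι : Type*) [Finite ι] (k : ℕ) (hk : 2 ≤ k)
    (b : ι → Fin k) (hb : Function.Surjective b) :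
    Submodule.span K
      (⋃ σ : Equiv.Perm ι,
        (fun v => v ∘ σ) '' {v : ι → U | ∀ i j, b i = b j → v i = v j}) = ⊤ := by
  classical
  have := Fintype.ofFinite ι
  set S := Submodule.span K
    (⋃ σ : Equiv.Perm ι,
      (fun v => v ∘ σ) '' {v : ι → U | ∀ i j, b i = b j → v i = v j}) with hSdef
  have hgen (σ : Equiv.Perm ι) (v : ι → U) (hv : ∀ i j, b i = b j → v i = v j) : v ∘ σ ∈ S :=
    Submodule.subset_span (Set.mem_iUnion.mpr ⟨σ, v, hv, rfl⟩)
  have hS (τ : Equiv.Perm ι) : ∀ v ∈ S, v ∘ τ ∈ S := by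
    suffices h : S ≤ S.comap (LinearMap.funLeft K U τ) from fun v hv => h hv
    rw [hSdef, Submodule.span_le]
    intro w hw
    obtain ⟨σ, v, hv, rfl⟩ := Set.mem_iUnion.mp hw
    exact hgen (τ.trans σ) v hv
  obtain ⟨p, hp⟩ := hb ⟨0, by omega⟩
  obtain ⟨q, hq⟩ := hb ⟨1, by omega⟩
  have hbpq : b q ≠ b p := by simp [hp, hq]
  have hpq : p ≠ q := fun h => hbpq (h ▸ rfl)
  have hsingle (i : ι) (u : U) : Pi.single i u ∈ S := by
    refine Submodule.single_mem_of_perm_invariant hS hpq ?_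
      (hgen 1 (fun _ => u) fun _ _ _ => rfl) i
    let v : ι → U := fun x => if b x = b p then u else 0
    have hv : ∀ i j, b i = b j → v i = v j := fun i j h => by simp [v, h]
    convert S.sub_mem (hgen 1 v hv) (hgen (Equiv.swap p q) v hv) using 1
    ext x
    rcases eq_or_ne x p with rfl | hxp
    · simp [v, hpq, hbpq]
    · rcases eq_or_ne x q with rfl | hxq
      · simp [v, hxp, hbpq]
      · simp [v, hxp, hxq, Equiv.swap_apply_of_ne_of_ne]
  refine (Submodule.eq_top_iff').mpr fun f => ?_
  rw [← Finset.univ_sum_single f]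
  exact S.sum_mem fun i _ => hsingle i (f i)
end

section
/- Let m, n ≥ 1 be integers, σ ∈ Perm(Fin m), and let γ be the number of orbits of the cyclic group generated by σ acting on Fin m (i.e., the number of cycles of σ, counting fixed points). Let T_σ be the ℂ-linear automorphism of Fin m → (Fin n → ℂ) given by v ↦ v ∘ σ. Then every root of the characteristic polynomial of T_σ is a root of unity, and the sum, over the multiset of roots λ of this characteristic polynomial counted with multiplicity, of the unique real number t(λ) ∈ [0,1) with λ = exp(2πi·t(λ)), equals n(m − γ)/2. (This is the computation age(σ) = (m−γ)/2 · n used in the proof of Theorem 3 of the paper.) -/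
open Polynomial in
theorem LinearMap.isSemisimple_of_pow_eq_one {V : Type*} [AddCommGroup V] [Module ℂ V]
    {f : Module.End ℂ V} {k : ℕ} (hk : 0 < k) (hf : f ^ k = 1) : f.IsSemisimple := by
  refine Module.End.isSemisimple_of_squarefree_aeval_eq_zero (p := X ^ k - C 1)
    (separable_X_pow_sub_C 1 (by exact_mod_cast hk.ne') one_ne_zero).squarefree ?_
  simp [hf]

theorem LinearMap.pow_eq_one_of_mem_roots_charpoly {V : Type*} [AddCommGroup V] [Module ℂ V]
    [FiniteDimensional ℂ V] {f : Module.End ℂ V} {k : ℕ} (hf : f ^ k = 1) {z : ℂ}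
    (hz : z ∈ f.charpoly.roots) : z ^ k = 1 := by
  have hz' : f.HasEigenvalue z :=
    (Module.End.hasEigenvalue_iff_isRoot_charpoly f z).2 (Polynomial.isRoot_of_mem_roots hz)
  obtain ⟨v, hv⟩ := hz'.exists_hasEigenvector
  have h := hv.pow_apply k
  rw [hf, Module.End.one_apply] at h
  have h0 : (z ^ k - 1) • v = 0 := by rw [sub_smul, ← h, one_smul, sub_self]
  exact sub_eq_zero.1 ((smul_eq_zero.1 h0).resolve_right hv.2)

theorem LinearMap.funLeft_pow_orderOf {ι W : Type*} [AddCommGroup W] [Module ℂ W]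
    (σ : Equiv.Perm ι) :
    (LinearMap.funLeft ℂ W σ : Module.End ℂ (ι → W)) ^ orderOf σ = 1 := by
  have h (k : ℕ) : (LinearMap.funLeft ℂ W σ : Module.End ℂ (ι → W)) ^ k =
      LinearMap.funLeft ℂ W ⇑(σ ^ k) := by
    induction k with
    | zero => rfl
    | succ k ih => rw [pow_succ, ih, pow_succ']; rfl
  rw [h, pow_orderOf_eq_one]
  rfl

/-- Functions fixed by precomposition with `σ` are the functions on the orbits of `σ`. -/
def fixedFunctionsEquiv {ι W : Type*} [AddCommGroup W] [Module ℂ W] (σ : Equiv.Perm ι) :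
    Module.End.eigenspace (LinearMap.funLeft ℂ W σ) 1 ≃ₗ[ℂ]
      (MulAction.orbitRel.Quotient (Subgroup.zpowers σ) ι → W) where
  toFun v := Quotient.lift v.1 <| by
    rintro a b ⟨⟨g, hg⟩, rfl⟩
    have hv : ∀ i, v.1 (σ i) = v.1 i := fun i => by
      simpa using congrFun (Module.End.mem_eigenspace_iff.1 v.2) i
    change v.1 (g b) = v.1 b
    obtain ⟨k, rfl⟩ := hg
    change v.1 ((σ ^ k) b) = v.1 b
    induction k using Int.induction_on with
    | zero => rfl
    | succ k ih => rw [add_comm, zpow_add, zpow_one, Equiv.Perm.mul_apply, hv, ih]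
    | pred k ih =>
      rw [← ih, ← hv ((σ ^ (-(k : ℤ) - 1)) b), ← Equiv.Perm.mul_apply, ← zpow_one_add,
        add_sub_cancel]
  map_add' v w := by
    ext q
    induction q using Quotient.inductionOn
    rfl
  map_smul' c v := by
    ext q
    induction q using Quotient.inductionOn
    rfl
  invFun u := ⟨fun i => u (Quotient.mk _ i), by
    rw [Module.End.mem_eigenspace_iff, one_smul]
    ext i
    exact congrArg u (Quotient.sound ⟨⟨σ, Subgroup.mem_zpowers σ⟩, rfl⟩)⟩
  left_inv v := rfl
  right_inv u := by
    ext q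
    induction q using Quotient.inductionOn
    rfl

theorem LinearMap.count_one_roots_charpoly_funLeft {ι W : Type*} [Finite ι] [AddCommGroup W]
    [Module ℂ W] [FiniteDimensional ℂ W] (σ : Equiv.Perm ι) :
    (LinearMap.funLeft ℂ W σ).charpoly.roots.count 1 =
      Nat.card (MulAction.orbitRel.Quotient (Subgroup.zpowers σ) ι) * Module.finrank ℂ W := by
  have := Fintype.ofFinite (MulAction.orbitRel.Quotient (Subgroup.zpowers σ) ι)
  have hs := (LinearMap.isSemisimple_of_pow_eq_one (orderOf_pos σ)
    (LinearMap.funLeft_pow_orderOf (W := W) σ)).isFinitelySemisimple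
  rw [Polynomial.count_roots, ← LinearMap.finrank_maxGenEigenspace_eq,
    hs.maxGenEigenspace_eq_eigenspace, (fixedFunctionsEquiv σ).finrank_eq,
    Module.finrank_pi_fintype, Finset.sum_const, Finset.card_univ, Nat.card_eq_fintype_card,
    smul_eq_mul]

open ComplexConjugate in
theorem LinearMap.roots_charpoly_funLeft_map_conj {ι κ : Type*} [Fintype ι] [Fintype κ]
    (σ : Equiv.Perm ι) :
    (LinearMap.funLeft ℂ (κ → ℂ) σ).charpoly.roots.map conj =
      (LinearMap.funLeft ℂ (κ → ℂ) σ).charpoly.roots := by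
  classical
  have hp : (LinearMap.funLeft ℂ (κ → ℂ) σ).charpoly.map (starRingEnd ℂ) =
      (LinearMap.funLeft ℂ (κ → ℂ) σ).charpoly := by
    rw [← LinearMap.charpoly_toMatrix _ (Pi.basis fun _ : ι => Pi.basisFun ℂ κ),
      ← Matrix.charpoly_map]
    congr 1
    ext ⟨i, a⟩ ⟨j, b⟩
    simp only [LinearMap.toMatrix_apply, LinearMap.funLeft_apply, Matrix.map_apply, Pi.basis_apply,
      Pi.basis_repr, Pi.basisFun_apply, Pi.basisFun_repr, Pi.single_apply]
    by_cases hij : σ i = j <;> by_cases hab : a = b <;> simp [hij, hab]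
  conv_rhs => rw [← hp]
  exact Polynomial.roots_map_of_injective_of_card_eq_natDegree (starRingEnd ℂ).injective
    (IsAlgClosed.card_roots_eq_natDegree)

open ComplexConjugate in
theorem Complex.fract_arg_add_fract_arg_conj {z : ℂ} (hz : ‖z‖ = 1) :
    Int.fract (arg z / (2 * Real.pi)) + Int.fract (arg (conj z) / (2 * Real.pi)) =
      if 1 = z then 0 else 1 := by
  have hpi := Real.pi_pos
  rw [arg_conj]
  split_ifs with h h1 h1
  · simp [← h1, hpi.ne] at h
  · have : Real.pi / (2 * Real.pi) = 1 / 2 := by field_simp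
    rw [h, this, Int.fract_eq_self.2 (by norm_num)]
    norm_num
  · simp [← h1]
  · have h0 : arg z ≠ 0 := fun h0 => h1 <| by
      rw [← norm_mul_exp_arg_mul_I z, h0, hz]
      simp
    have hf : Int.fract (arg z / (2 * Real.pi)) ≠ 0 := fun hf => by
      obtain ⟨k, hk⟩ := Int.fract_eq_zero_iff.1 hf
      rw [eq_div_iff (by positivity)] at hk
      have hlt := (arg_le_pi z).lt_of_ne h
      have hgt := neg_pi_lt_arg z
      have hk1 : (k : ℝ) < 1 := by nlinarith
      have hk2 : (-1 : ℝ) < k := by nlinarith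
      have : k = 0 := by
        have : k < 1 := by exact_mod_cast hk1
        have : -1 < k := by exact_mod_cast hk2
        lia
      simp [this] at hk
      exact h0 hk.symm
    rw [neg_div, Int.fract_neg hf]
    ring

open ComplexConjugate in
theorem Multiset.sum_fract_arg_of_map_conj_eq {s : Multiset ℂ} (hs : s.map conj = s)
    (h : ∀ z ∈ s, ‖z‖ = 1) :
    (s.map fun z => Int.fract (Complex.arg z / (2 * Real.pi))).sum =
      ((s.card : ℝ) - s.count 1) / 2 := by
  have hsum : (s.map fun z => Int.fract (Complex.arg z / (2 * Real.pi))).sum =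
      (s.map fun z => Int.fract (Complex.arg (conj z) / (2 * Real.pi))).sum := by
    conv_lhs => rw [← hs, Multiset.map_map]
    rfl
  have hcount (t : Multiset ℂ) : (t.map fun z => if 1 = z then (0 : ℝ) else 1).sum =
      t.card - t.count 1 := by
    induction t using Multiset.induction_on with
    | empty => simp
    | cons a t ih =>
      rw [Multiset.map_cons, Multiset.sum_cons, ih, Multiset.card_cons, Multiset.count_cons]
      split_ifs <;> push_cast <;> ring
  rw [← hcount, ← Multiset.map_congr rfl fun z hz =>
    Complex.fract_arg_add_fract_arg_conj (h z hz), Multiset.sum_map_add, ← hsum]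
  ring

/-- Let `σ` be a permutation of `Fin m` and `γ` the number of orbits of the cyclic
group generated by `σ` on `Fin m` (the number of cycles of `σ`, counting fixed
points).  For the `ℂ`-linear automorphism `T_σ : v ↦ v ∘ σ` of `Fin m → (Fin n → ℂ)`,
every root of its characteristic polynomial is a root of unity, and the sum over the
multiset of roots `z` (with multiplicity) of the unique `t(z) ∈ [0,1)` with
`z = exp(2πi·t(z))` — namely `Int.fract (arg z / (2π))` — equals `n(m - γ)/2`.
(The computation `age σ = (m - γ)/2 · n` from the proof of Theorem 3.) -/
theorem age_perm_action
    (m n : ℕ) (hm : 1 ≤ m) (hn : 1 ≤ n) (σ : Equiv.Perm (Fin m))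
    (γ : ℕ)
    (hγ : γ = Nat.card (MulAction.orbitRel.Quotient (Subgroup.zpowers σ) (Fin m))) :
    (∀ z ∈ (LinearMap.charpoly (LinearMap.funLeft ℂ (Fin n → ℂ) ⇑σ)).roots,
        ∃ k : ℕ, 0 < k ∧ z ^ k = 1) ∧
    ((LinearMap.charpoly (LinearMap.funLeft ℂ (Fin n → ℂ) ⇑σ)).roots.map
        (fun z => Int.fract (Complex.arg z / (2 * Real.pi)))).sum
      = (n : ℝ) * ((m : ℝ) - (γ : ℝ)) / 2 := by
  have hpow {z : ℂ} (hz : z ∈ (LinearMap.funLeft ℂ (Fin n → ℂ) ⇑σ).charpoly.roots) :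
      z ^ orderOf σ = 1 :=
    LinearMap.pow_eq_one_of_mem_roots_charpoly (LinearMap.funLeft_pow_orderOf σ) hz
  refine ⟨fun z hz => ⟨orderOf σ, orderOf_pos σ, hpow hz⟩, ?_⟩
  rw [Multiset.sum_fract_arg_of_map_conj_eq (LinearMap.roots_charpoly_funLeft_map_conj σ)
      fun z hz => Complex.norm_eq_one_of_pow_eq_one (hpow hz) (orderOf_pos σ).ne',
    LinearMap.count_one_roots_charpoly_funLeft, ← hγ, IsAlgClosed.card_roots_eq_natDegree,
    LinearMap.charpoly_natDegree, Module.finrank_pi_fintype]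
  simp
  ring
end
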